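/- arXiv:math/0603551 — 5 statements merged into one kernel-verified Lean document; each statement's English description precedes it below -/
import Mathlib

section
/- Let L be a d-dimensional linear subspace of ℂ^n with 1 ≤ d ≤ n − 1 such that every d-element subset of {1,…,n} is a basis of L (i.e., all Plücker coordinates of L are nonzero). Then for every nonzero u ∈ L and every nonzero v ∈ L^⊥ there exists an index i ∈ {1,…,n} with u_i v_i ≠ 0. -/
/-- The coordinate projection onto the coordinates in `I`. -/
def coordProj {ι : Type*} (I : Finset ι) : (ι → ℂ) →ₗ[ℂ] ({ i // i ∈ I } → ℂ) :=
  LinearMap.funLeft ℂ ℂ (fun i : { i // i ∈ I } => (i : ι))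

/-- `I` is a basis of the subspace `L` if the coordinate projection onto the
coordinates in `I` restricts to a linear isomorphism on `L`. -/
def IsBasisOf {ι : Type*} (L : Submodule ℂ (ι → ℂ)) (I : Finset ι) : Prop :=
  Function.Bijective fun v : L => coordProj I (v : ι → ℂ)

/-- The orthogonal complement with respect to the standard symmetric bilinear
form `⟨x, y⟩ = ∑ i, x i * y i`. -/
noncomputable def perp {ι : Type*} [Fintype ι] (L : Submodule ℂ (ι → ℂ)) : Submodule ℂ (ι → ℂ) where
  carrier := {y | ∀ x ∈ L, ∑ i, x i * y i = 0}
  zero_mem' := by intro x hx; simp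
  add_mem' := by
    intro a b ha hb x hx
    have h : ∑ i, x i * (a + b) i = (∑ i, x i * a i) + ∑ i, x i * b i := by
      rw [← Finset.sum_add_distrib]
      exact Finset.sum_congr rfl fun i _ => by simp [mul_add]
    simp only [Set.mem_setOf_eq] at *
    rw [h, ha x hx, hb x hx, add_zero]
  smul_mem' := by
    intro c y hy x hx
    have h : ∑ i, x i * (c • y) i = c * ∑ i, x i * y i := by
      rw [Finset.mul_sum]
      exact Finset.sum_congr rfl fun i _ => by simp [smul_eq_mul]; ring
    simp only [Set.mem_setOf_eq] at *
    rw [h, hy x hx, mul_zero]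

/-- The subspace of `ℂ^n` spanned by the coordinates in `A`. -/
noncomputable def coordSub {ι : Type*} (A : Finset ι) : Submodule ℂ (ι → ℂ) where
  carrier := {x | ∀ i ∉ A, x i = 0}
  zero_mem' := by intro i _; rfl
  add_mem' := by intro a b ha hb i hi; simp [ha i hi, hb i hi]
  smul_mem' := by intro c x hx i hi; simp [hx i hi]

/-- A vector of `L` vanishing on a basis of `L` is zero. -/
theorem IsBasisOf.eq_zero_of_forall_mem {ι : Type*} {L : Submodule ℂ (ι → ℂ)} {I : Finset ι}
    (h : IsBasisOf L I) {u : ι → ℂ} (hu : u ∈ L) (hI : ∀ i ∈ I, u i = 0) : u = 0 := by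
  have key : (⟨u, hu⟩ : L) = 0 := h.injective <| by
    funext i
    exact hI i i.2
  exact congrArg Subtype.val key

/-- A vector of `perp L` supported on a basis of `L` is zero. -/
theorem IsBasisOf.eq_zero_of_mem_perp {ι : Type*} [Fintype ι] {L : Submodule ℂ (ι → ℂ)}
    {I : Finset ι} (h : IsBasisOf L I) {v : ι → ℂ} (hv : v ∈ perp L)
    (hI : ∀ i ∉ I, v i = 0) : v = 0 := by
  classical
  funext j
  by_cases hj : j ∈ I
  · obtain ⟨x, hx⟩ := h.surjective (Pi.single ⟨j, hj⟩ 1)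
    have hxI : ∀ i (hi : i ∈ I), (x : ι → ℂ) i = if i = j then 1 else 0 := fun i hi => by
      have := congrFun hx ⟨i, hi⟩
      simpa [coordProj, LinearMap.funLeft_apply, Pi.single_apply] using this
    have hsum : ∑ i, (x : ι → ℂ) i * v i = v j := by
      rw [Finset.sum_eq_single j]
      · simp [hxI j hj]
      · intro i _ hij
        by_cases hi : i ∈ I
        · simp [hxI i hi, hij]
        · simp [hI i hi]
      · simp
    rw [← hsum]
    exact hv x x.2
  · exact hI j hj

/-- if every `d`-element subset is a basis of the `d`-dimensional subspace
`L ⊆ ℂ^n` (`1 ≤ d ≤ n - 1`), then for every nonzero `u ∈ L` and nonzero `v ∈ L^⊥` there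
is a coordinate `i` with `u i * v i ≠ 0`. -/
theorem stmt3 {n d : ℕ} (hd : 1 ≤ d) (hdn : d ≤ n - 1)
    (L : Submodule ℂ (Fin n → ℂ)) (hdim : Module.finrank ℂ L = d)
    (hall : ∀ I : Finset (Fin n), I.card = d → IsBasisOf L I)
    (u : Fin n → ℂ) (hu : u ∈ L) (hu0 : u ≠ 0)
    (v : Fin n → ℂ) (hv : v ∈ perp L) (hv0 : v ≠ 0) :
    ∃ i : Fin n, u i * v i ≠ 0 := by
  classical
  by_contra! hzero
  let Z : Finset (Fin n) := Finset.univ.filter fun i => u i = 0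
  rcases le_total d Z.card with hZ | hZ
  · obtain ⟨I, hIZ, hI⟩ := Finset.exists_subset_card_eq hZ
    exact hu0 <| (hall I hI).eq_zero_of_forall_mem hu fun i hi =>
      (Finset.mem_filter.mp (hIZ hi)).2
  · obtain ⟨I, hZI, hI⟩ := Finset.exists_superset_card_eq hZ (by simp; omega)
    refine hv0 <| (hall I hI).eq_zero_of_mem_perp hv fun i hi => ?_
    refine (mul_eq_zero.mp (hzero i)).resolve_left fun hui => hi (hZI ?_)
    simp [Z, hui]
end

section
/- For all integers n and d with 1 ≤ d ≤ n − 1, one has ∑_{i=1}^{min(d, n−d)} (−1)^{i−1} · (n−i−1)! / ((d−i)! · (n−d−i)! · (i−1)!) = 1. -/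
open Finset in
theorem sum_neg_one_pow_mul_choose_mul_choose (a b : ℕ) :
    ∑ j ∈ range (b + 1), (-1 : ℤ) ^ j * b.choose j * (a + b - j).choose b = 1 := by
  have h := fwdDiff_iter_eq_sum_shift (1 : ℕ) (fun x : ℕ ↦ (x.choose b : ℤ)) b a
  have hc := congrFun (fwdDiff_iter_choose 0 b) a
  simp only [add_zero] at hc
  rw [hc, ← sum_range_reflect] at h
  simp only [Nat.choose_zero_right, Nat.cast_one] at h
  refine Eq.trans ?_ h.symm
  refine sum_congr rfl fun j hj ↦ ?_
  have hj' : j ≤ b := Nat.lt_succ_iff.mp (mem_range.mp hj)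
  rw [show b + 1 - 1 - j = b - j by omega, Nat.sub_sub_self hj', Nat.choose_symm hj',
    show a + (b - j) • 1 = a + b - j by simp; omega, smul_eq_mul]

theorem factorial_div_eq_choose_mul_choose {a b j : ℕ} (ha : j ≤ a) (hb : j ≤ b) :
    ((a + b - j).factorial : ℚ) / ((a - j).factorial * (b - j).factorial * j.factorial) =
      b.choose j * (a + b - j).choose b := by
  rw [Nat.cast_choose ℚ hb, Nat.cast_choose ℚ (show b ≤ a + b - j by omega),
    show a + b - j - b = a - j by omega]
  have := Nat.factorial_ne_zero
  field_simp

/-- for `1 ≤ d ≤ n - 1`,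
`∑_{i=1}^{min(d, n-d)} (-1)^{i-1} (n-i-1)! / ((d-i)! (n-d-i)! (i-1)!) = 1`. -/
theorem stmt5 (n d : ℕ) (hd : 1 ≤ d) (hdn : d ≤ n - 1) :
    ∑ i ∈ Finset.Icc 1 (min d (n - d)),
      (-1 : ℚ) ^ (i - 1) * (Nat.factorial (n - i - 1) : ℚ) /
        ((Nat.factorial (d - i) : ℚ) * (Nat.factorial (n - d - i) : ℚ) *
          (Nat.factorial (i - 1) : ℚ)) = 1 := by
  obtain ⟨a, rfl⟩ := Nat.exists_eq_add_of_le' hd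
  obtain ⟨b, rfl⟩ : ∃ b, n = a + b + 2 := ⟨n - a - 2, by omega⟩
  have h : (∑ j ∈ Finset.range (b + 1),
      (-1 : ℚ) ^ j * b.choose j * (a + b - j).choose b) = 1 := by
    exact_mod_cast sum_neg_one_pow_mul_choose_mul_choose a b
  refine Eq.trans ?_ h
  rw [← Finset.sum_subset (Finset.range_mono (show min a b + 1 ≤ b + 1 by omega)),
    ← Finset.Ico_add_one_right_eq_Icc, Finset.sum_Ico_eq_sum_range]
  · refine Finset.sum_congr (by congr 1; omega) fun j hj ↦ ?_
    rw [Finset.mem_range] at hj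
    rw [show 1 + j - 1 = j by omega, show a + b + 2 - (1 + j) - 1 = a + b - j by omega,
      show a + 1 - (1 + j) = a - j by omega,
      show a + b + 2 - (a + 1) - (1 + j) = b - j by omega, mul_div_assoc,
      factorial_div_eq_choose_mul_choose (by omega) (by omega), mul_assoc]
  · intro j hj hj'
    rw [Finset.mem_range] at hj hj'
    rw [Nat.choose_eq_zero_of_lt (show a + b - j < b by omega), Nat.cast_zero, mul_zero]
end

section
/- Let L₁ ⊆ ℂ^{n₁} and L₂ ⊆ ℂ^{n₂} be linear subspaces of dimensions d₁ and d₂ with 1 ≤ d_r ≤ n_r − 1, each of which is not contained in any coordinate hyperplane and contains no standard basis vector. Fix e₁ ∈ {1,…,n₁}, e₂ ∈ {1,…,n₂} and α ∈ ℂ ∖ {0}. Then the orthogonal complement of the 2-sum satisfies (L₁ +₂(α) L₂)^⊥ = L₁^⊥ +₂(−α^{−1}) L₂^⊥, where on each side the orthogonal complement is taken with respect to the standard symmetric bilinear form ⟨x,y⟩ = ∑ x_i y_i on the relevant coordinate space. -/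
/-- The linear constraint `u e₁ = α * v e₂` defining the 2-sum. -/
noncomputable def twoSumConstraint {ι₁ ι₂ : Type*} (e₁ : ι₁) (e₂ : ι₂) (α : ℂ) :
    ((ι₁ → ℂ) × (ι₂ → ℂ)) →ₗ[ℂ] ℂ where
  toFun p := p.1 e₁ - α * p.2 e₂
  map_add' p q := by
    simp only [Prod.fst_add, Prod.snd_add, Pi.add_apply]; ring
  map_smul' c p := by
    simp only [Prod.smul_fst, Prod.smul_snd, Pi.smul_apply, smul_eq_mul, RingHom.id_apply]; ring

/-- The projection deleting the coordinates `e₁` and `e₂`. -/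
noncomputable def twoSumProj {ι₁ ι₂ : Type*} (e₁ : ι₁) (e₂ : ι₂) :
    ((ι₁ → ℂ) × (ι₂ → ℂ)) →ₗ[ℂ] (({i : ι₁ // i ≠ e₁} ⊕ {j : ι₂ // j ≠ e₂}) → ℂ) where
  toFun p := Sum.elim (fun i => p.1 i.1) (fun j => p.2 j.1)
  map_add' p q := by funext x; cases x <;> simp
  map_smul' c p := by funext x; cases x <;> simp

/-- The 2-sum `L₁ +₂(α) L₂` of two subspaces: the image of
`{(u,v) ∈ L₁ × L₂ : u e₁ = α * v e₂}` under the projection deleting coordinates `e₁, e₂`. -/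
noncomputable def twoSum {ι₁ ι₂ : Type*} (L₁ : Submodule ℂ (ι₁ → ℂ))
    (L₂ : Submodule ℂ (ι₂ → ℂ)) (e₁ : ι₁) (e₂ : ι₂) (α : ℂ) :
    Submodule ℂ (({i : ι₁ // i ≠ e₁} ⊕ {j : ι₂ // j ≠ e₂}) → ℂ) :=
  ((L₁.prod L₂) ⊓ LinearMap.ker (twoSumConstraint e₁ e₂ α)).map (twoSumProj e₁ e₂)

section TwoSumPerp

variable {ι₁ ι₂ : Type*}

theorem mem_perp {ι : Type*} [Fintype ι] {L : Submodule ℂ (ι → ℂ)} {y : ι → ℂ} :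
    y ∈ perp L ↔ ∀ x ∈ L, ∑ i, x i * y i = 0 :=
  Iff.rfl

theorem mem_twoSum {L₁ : Submodule ℂ (ι₁ → ℂ)} {L₂ : Submodule ℂ (ι₂ → ℂ)}
    {e₁ : ι₁} {e₂ : ι₂} {α : ℂ} {y : ({i : ι₁ // i ≠ e₁} ⊕ {j : ι₂ // j ≠ e₂}) → ℂ} :
    y ∈ twoSum L₁ L₂ e₁ e₂ α ↔ ∃ u ∈ L₁, ∃ v ∈ L₂, u e₁ = α * v e₂ ∧
      Sum.elim (fun i => u i.1) (fun j => v j.1) = y := by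
  constructor
  · rintro ⟨⟨u, v⟩, ⟨⟨hu, hv⟩, huv⟩, rfl⟩
    exact ⟨u, hu, v, hv, sub_eq_zero.mp huv, rfl⟩
  · rintro ⟨u, hu, v, hv, huv, rfl⟩
    exact ⟨(u, v), ⟨⟨hu, hv⟩, sub_eq_zero.mpr huv⟩, rfl⟩

variable [Fintype ι₁] [Fintype ι₂] [DecidableEq ι₁] [DecidableEq ι₂]

theorem mem_perp_twoSum {L₁ : Submodule ℂ (ι₁ → ℂ)} {L₂ : Submodule ℂ (ι₂ → ℂ)}
    {e₁ : ι₁} {e₂ : ι₂} {α : ℂ} {y : ({i : ι₁ // i ≠ e₁} ⊕ {j : ι₂ // j ≠ e₂}) → ℂ} :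
    y ∈ perp (twoSum L₁ L₂ e₁ e₂ α) ↔ ∀ u ∈ L₁, ∀ v ∈ L₂, u e₁ = α * v e₂ →
      ∑ i : {i // i ≠ e₁}, u i * y (.inl i) + ∑ j : {j // j ≠ e₂}, v j * y (.inr j) = 0 := by
  rw [mem_perp]
  constructor
  · intro h u hu v hv huv
    simpa [Fintype.sum_sum_type] using h _ (mem_twoSum.mpr ⟨u, hu, v, hv, huv, rfl⟩)
  · intro h x hx
    obtain ⟨u, hu, v, hv, huv, rfl⟩ := mem_twoSum.mp hx
    simpa [Fintype.sum_sum_type] using h u hu v hv huv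

theorem twoSum_perp_le_perp_twoSum (L₁ : Submodule ℂ (ι₁ → ℂ)) (L₂ : Submodule ℂ (ι₂ → ℂ))
    (e₁ : ι₁) (e₂ : ι₂) {α : ℂ} (hα : α ≠ 0) :
    twoSum (perp L₁) (perp L₂) e₁ e₂ (-α⁻¹) ≤ perp (twoSum L₁ L₂ e₁ e₂ α) := by
  intro y hy
  obtain ⟨a, ha, b, hb, hab, rfl⟩ := mem_twoSum.mp hy
  refine mem_perp_twoSum.mpr fun u hu v hv huv => ?_
  have h₁ := mem_perp.mp ha u hu
  have h₂ := mem_perp.mp hb v hv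
  rw [Fintype.sum_eq_add_sum_subtype_ne _ e₁] at h₁
  rw [Fintype.sum_eq_add_sum_subtype_ne _ e₂] at h₂
  have h : u e₁ * a e₁ + v e₂ * b e₂ = 0 := by
    rw [huv, hab]
    field_simp
    ring
  simp only [Sum.elim_inl, Sum.elim_inr]
  linear_combination h₁ + h₂ - h

/-- A linear functional on `L₁ × L₂` that vanishes on the kernel of the constraint is a multiple
of the constraint. -/
theorem exists_multiplier_of_mem_perp_twoSum {L₁ : Submodule ℂ (ι₁ → ℂ)}
    {L₂ : Submodule ℂ (ι₂ → ℂ)} {e₁ : ι₁} {e₂ : ι₂} {α : ℂ} (hL₁ : ∃ x ∈ L₁, x e₁ ≠ 0)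
    {y : ({i : ι₁ // i ≠ e₁} ⊕ {j : ι₂ // j ≠ e₂}) → ℂ}
    (hy : y ∈ perp (twoSum L₁ L₂ e₁ e₂ α)) :
    ∃ c : ℂ, ∀ u ∈ L₁, ∀ v ∈ L₂,
      ∑ i : {i // i ≠ e₁}, u i * y (.inl i) + ∑ j : {j // j ≠ e₂}, v j * y (.inr j) =
        c * (u e₁ - α * v e₂) := by
  obtain ⟨x, hx, hxe⟩ := hL₁
  refine ⟨(∑ i : {i // i ≠ e₁}, x i * y (.inl i)) / x e₁, fun u hu v hv => ?_⟩
  set t : ℂ := (u e₁ - α * v e₂) / x e₁ with ht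
  have h := mem_perp_twoSum.mp hy (u - t • x) (L₁.sub_mem hu (L₁.smul_mem t hx)) v hv
    (by simp only [Pi.sub_apply, Pi.smul_apply, smul_eq_mul, ht]; field_simp; ring)
  simp only [Pi.sub_apply, Pi.smul_apply, smul_eq_mul, sub_mul, mul_assoc,
    Finset.sum_sub_distrib, ← Finset.mul_sum] at h
  rw [ht] at h
  linear_combination h

theorem perp_twoSum (L₁ : Submodule ℂ (ι₁ → ℂ)) (L₂ : Submodule ℂ (ι₂ → ℂ))
    (e₁ : ι₁) (e₂ : ι₂) (α : ℂ) (hα : α ≠ 0) (hL₁ : ∃ x ∈ L₁, x e₁ ≠ 0) :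
    perp (twoSum L₁ L₂ e₁ e₂ α) = twoSum (perp L₁) (perp L₂) e₁ e₂ (-α⁻¹) := by
  refine le_antisymm (fun y hy => ?_) (twoSum_perp_le_perp_twoSum L₁ L₂ e₁ e₂ hα)
  obtain ⟨c, hc⟩ := exists_multiplier_of_mem_perp_twoSum hL₁ hy
  refine mem_twoSum.mpr
    ⟨fun i => if h : i = e₁ then -c else y (.inl ⟨i, h⟩), mem_perp.mpr fun u hu => ?_,
      fun j => if h : j = e₂ then c * α else y (.inr ⟨j, h⟩), mem_perp.mpr fun v hv => ?_, ?_, ?_⟩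
  · have h := hc u hu 0 L₂.zero_mem
    simp only [Pi.zero_apply, zero_mul, Finset.sum_const_zero, mul_zero] at h
    rw [Fintype.sum_eq_add_sum_subtype_ne _ e₁, dif_pos rfl,
      Finset.sum_congr rfl fun (i : {i // i ≠ e₁}) _ => by rw [dif_neg i.2]]
    linear_combination h
  · have h := hc 0 L₁.zero_mem v hv
    simp only [Pi.zero_apply, zero_mul, Finset.sum_const_zero] at h
    rw [Fintype.sum_eq_add_sum_subtype_ne _ e₂, dif_pos rfl,
      Finset.sum_congr rfl fun (j : {j // j ≠ e₂}) _ => by rw [dif_neg j.2]]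
    linear_combination h
  · simp only [dif_pos]
    field_simp
  · ext (i | j)
    · simp [i.2]
    · simp [j.2]

end TwoSumPerp

/-- the orthogonal complement of the 2-sum satisfies
`(L₁ +₂(α) L₂)^⊥ = L₁^⊥ +₂(-α⁻¹) L₂^⊥`. -/
theorem stmt6 {n₁ n₂ d₁ d₂ : ℕ}
    (L₁ : Submodule ℂ (Fin n₁ → ℂ)) (L₂ : Submodule ℂ (Fin n₂ → ℂ))
    (h₁ : Module.finrank ℂ L₁ = d₁) (h₂ : Module.finrank ℂ L₂ = d₂)
    (hd₁ : 1 ≤ d₁) (hd₁' : d₁ ≤ n₁ - 1) (hd₂ : 1 ≤ d₂) (hd₂' : d₂ ≤ n₂ - 1)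
    (hcoord₁ : ∀ a : Fin n₁, ∃ x ∈ L₁, x a ≠ 0)
    (hbv₁ : ∀ a : Fin n₁, Pi.single a (1 : ℂ) ∉ L₁)
    (hcoord₂ : ∀ a : Fin n₂, ∃ x ∈ L₂, x a ≠ 0)
    (hbv₂ : ∀ a : Fin n₂, Pi.single a (1 : ℂ) ∉ L₂)
    (e₁ : Fin n₁) (e₂ : Fin n₂) (α : ℂ) (hα : α ≠ 0) :
    perp (twoSum L₁ L₂ e₁ e₂ α) = twoSum (perp L₁) (perp L₂) e₁ e₂ (-α⁻¹) := by
  exact perp_twoSum L₁ L₂ e₁ e₂ α hα (hcoord₁ e₁)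
end

section
/- Let L₁ ⊆ ℂ^{n₁} and L₂ ⊆ ℂ^{n₂} be linear subspaces of dimensions d₁ and d₂, fix e₁ ∈ {1,…,n₁}, e₂ ∈ {1,…,n₂} and α ∈ ℂ ∖ {0}, and assume that L₁ is not contained in the hyperplane {u : u_{e₁} = 0}, that e_{e₁} ∉ L₁, and that e_{e₂} ∉ L₂. Then the 2-sum L₁ +₂(α) L₂ is a linear subspace of ℂ^{n₁+n₂−2} of dimension d₁ + d₂ − 1. -/
/-- A linear map that is injective on a subspace preserves its dimension. -/
theorem finrank_map_of_disjoint_ker {K V V' : Type*} [Field K] [AddCommGroup V] [Module K V]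
    [AddCommGroup V'] [Module K V'] (f : V →ₗ[K] V') (W : Submodule K V)
    (h : Disjoint W (LinearMap.ker f)) :
    Module.finrank K (W.map f) = Module.finrank K W := by
  rw [← LinearMap.range_domRestrict]
  exact LinearMap.finrank_range_of_inj (LinearMap.injective_domRestrict_iff.mpr h)

/-- Intersecting a subspace with the kernel of a functional that does not vanish on it lowers its
dimension by one. -/
theorem finrank_inf_ker_add_one {K V : Type*} [Field K] [AddCommGroup V] [Module K V]
    [FiniteDimensional K V] (P : Submodule K V) (f : V →ₗ[K] K) (h : ∃ x ∈ P, f x ≠ 0) :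
    Module.finrank K (P ⊓ LinearMap.ker f : Submodule K V) + 1 = Module.finrank K P := by
  obtain ⟨x, hx, hfx⟩ := h
  have hne : f.domRestrict P ≠ 0 := fun h0 => hfx (LinearMap.congr_fun h0 ⟨x, hx⟩)
  rw [← Module.Dual.finrank_ker_add_one_of_ne_zero (f := f.domRestrict P) hne,
    ← Submodule.map_comap_subtype, Submodule.finrank_map_subtype_eq]
  rfl

/-- The dimension of a product of subspaces is the sum of their dimensions. -/
theorem finrank_submodule_prod {K V V' : Type*} [Field K] [AddCommGroup V] [Module K V]
    [AddCommGroup V'] [Module K V'] [FiniteDimensional K V] [FiniteDimensional K V']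
    (L : Submodule K V) (L' : Submodule K V') :
    Module.finrank K (L.prod L') = Module.finrank K L + Module.finrank K L' := by
  have hrange : LinearMap.range (L.subtype.prodMap L'.subtype) = L.prod L' := by
    rw [LinearMap.range_prodMap, Submodule.range_subtype, Submodule.range_subtype]
  rw [← hrange, LinearMap.finrank_range_of_inj
    (Function.Injective.prodMap L.subtype_injective L'.subtype_injective), Module.finrank_prod]

/-- A vector supported on a single coordinate and lying in a subspace that does not contain the
corresponding basis vector is zero. -/
theorem eq_zero_of_mem_of_single_notMem {K ι : Type*} [Field K] [DecidableEq ι]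
    {L : Submodule K (ι → K)} {e : ι} (he : Pi.single e (1 : K) ∉ L) {u : ι → K} (hu : u ∈ L)
    (h : ∀ i, i ≠ e → u i = 0) : u = 0 := by
  have hs : u = u e • Pi.single e (1 : K) := by
    ext i
    by_cases hi : i = e
    · subst hi; simp
    · simp [hi, h i hi]
  by_cases h0 : u e = 0
  · rw [hs, h0, zero_smul]
  · rw [hs] at hu
    exact absurd ((L.smul_mem_iff h0).mp hu) he

/-- The projection deleting `e₁` and `e₂` is injective on `L₁ × L₂` when neither subspace contains
the deleted basis vector. -/
theorem disjoint_prod_ker_twoSumProj {ι₁ ι₂ : Type*} [DecidableEq ι₁] [DecidableEq ι₂]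
    {L₁ : Submodule ℂ (ι₁ → ℂ)} {L₂ : Submodule ℂ (ι₂ → ℂ)} {e₁ : ι₁} {e₂ : ι₂}
    (he₁ : Pi.single e₁ (1 : ℂ) ∉ L₁) (he₂ : Pi.single e₂ (1 : ℂ) ∉ L₂) :
    Disjoint (L₁.prod L₂) (LinearMap.ker (twoSumProj e₁ e₂)) := by
  rw [Submodule.disjoint_def]
  rintro ⟨u, v⟩ ⟨hu, hv⟩ hker
  have hk : twoSumProj e₁ e₂ (u, v) = 0 := hker
  exact Prod.ext
    (eq_zero_of_mem_of_single_notMem he₁ hu fun i hi => congrFun hk (Sum.inl ⟨i, hi⟩))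
    (eq_zero_of_mem_of_single_notMem he₂ hv fun j hj => congrFun hk (Sum.inr ⟨j, hj⟩))

/-- if `L₁` is not contained in the hyperplane `{u : u e₁ = 0}`, and
neither `L₁` contains `e_{e₁}` nor `L₂` contains `e_{e₂}`, then the 2-sum
`L₁ +₂(α) L₂` has dimension `d₁ + d₂ - 1`. -/
theorem stmt7 {n₁ n₂ d₁ d₂ : ℕ}
    (L₁ : Submodule ℂ (Fin n₁ → ℂ)) (L₂ : Submodule ℂ (Fin n₂ → ℂ))
    (h₁ : Module.finrank ℂ L₁ = d₁) (h₂ : Module.finrank ℂ L₂ = d₂)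
    (e₁ : Fin n₁) (e₂ : Fin n₂) (α : ℂ) (hα : α ≠ 0)
    (hL₁ : ∃ x ∈ L₁, x e₁ ≠ 0)
    (he₁ : Pi.single e₁ (1 : ℂ) ∉ L₁)
    (he₂ : Pi.single e₂ (1 : ℂ) ∉ L₂) :
    Module.finrank ℂ (twoSum L₁ L₂ e₁ e₂ α) = d₁ + d₂ - 1 := by
  obtain ⟨x, hx, hxe⟩ := hL₁
  have hdim := finrank_inf_ker_add_one (L₁.prod L₂) (twoSumConstraint e₁ e₂ α)
    ⟨(x, 0), ⟨hx, L₂.zero_mem⟩, by simpa [twoSumConstraint] using hxe⟩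
  have hprod : Module.finrank ℂ (L₁.prod L₂) = d₁ + d₂ := by
    rw [finrank_submodule_prod, h₁, h₂]
  rw [twoSum, finrank_map_of_disjoint_ker _ _
    ((disjoint_prod_ker_twoSumProj he₁ he₂).mono_left inf_le_left)]
  omega
end

section
/- Let L be a d-dimensional linear subspace of ℂ^n and let e ∈ {1,…,n}. Then for every subset I ⊆ {1,…,n+1} with |I| = d, the set I is a basis of the parallel extension p_e(L) ⊆ ℂ^{n+1} if and only if either (n+1 ∉ I and I is a basis of L) or (n+1 ∈ I, e ∉ I, and (I ∖ {n+1}) ∪ {e} is a basis of L). In particular, which subsets are bases of p_e(L) is determined by which subsets are bases of L. -/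
/-- The parallel extension map `ℂ^n → ℂ^{n+1}`, `u ↦ (u₁, …, u_n, u_e)`,
repeating the `e`-th coordinate in the last position. -/
noncomputable def parExtMap (n : ℕ) (e : Fin n) : (Fin n → ℂ) →ₗ[ℂ] (Fin (n + 1) → ℂ) where
  toFun u := fun i => if h : (i : ℕ) < n then u ⟨i, h⟩ else u e
  map_add' u v := by funext i; by_cases h : (i : ℕ) < n <;> simp [h]
  map_smul' c u := by funext i; by_cases h : (i : ℕ) < n <;> simp [h]

theorem injective_coordProj_iff {ι : Type*} (L : Submodule ℂ (ι → ℂ)) (I : Finset ι) :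
    Function.Injective ((coordProj I).domRestrict L) ↔
      ∀ v ∈ L, (∀ i ∈ I, v i = 0) → v = 0 := by
  rw [injective_iff_map_eq_zero]
  simp [coordProj, funext_iff, LinearMap.funLeft_apply]

/-- A subspace on which the projection to `I` is injective has dimension at most `I.card`. -/
theorem finrank_le_card_of_forall {ι : Type*} (L : Submodule ℂ (ι → ℂ)) (I : Finset ι)
    (h : ∀ v ∈ L, (∀ i ∈ I, v i = 0) → v = 0) : Module.finrank ℂ L ≤ I.card := by
  simpa using LinearMap.finrank_le_finrank_of_injective ((injective_coordProj_iff L I).2 h)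

/-- For `I` of cardinality `finrank ℂ L`, being a basis amounts to injectivity of the
projection. -/
theorem isBasisOf_iff_forall {ι : Type*} [Finite ι] (L : Submodule ℂ (ι → ℂ)) (I : Finset ι)
    (hI : I.card = Module.finrank ℂ L) :
    IsBasisOf L I ↔ ∀ v ∈ L, (∀ i ∈ I, v i = 0) → v = 0 := by
  rw [← injective_coordProj_iff]
  change Function.Bijective ((coordProj I).domRestrict L) ↔ _
  refine ⟨fun h => h.1, fun h => ⟨h, ?_⟩⟩
  exact (LinearMap.injective_iff_surjective_of_finrank_eq_finrank (by simp [hI])).1 h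

@[simp]
theorem parExtMap_castSucc {n : ℕ} (e : Fin n) (u : Fin n → ℂ) (i : Fin n) :
    parExtMap n e u i.castSucc = u i := by
  simp [parExtMap]

@[simp]
theorem parExtMap_last {n : ℕ} (e : Fin n) (u : Fin n → ℂ) :
    parExtMap n e u (Fin.last n) = u e := by
  simp [parExtMap]

theorem parExtMap_injective {n : ℕ} (e : Fin n) : Function.Injective (parExtMap n e) := by
  intro u v h
  funext i
  simpa using congrFun h i.castSucc

theorem map_castSucc_preimage {n : ℕ} (J : Finset (Fin (n + 1))) :
    (J.preimage Fin.castSucc (Fin.castSucc_injective n).injOn).map Fin.castSuccEmb =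
      J.erase (Fin.last n) := by
  ext j
  induction j using Fin.lastCases with
  | last => simp
  | cast i => simp

/-- a `d`-element subset `J` of `{1,…,n+1}` is a basis of the parallel
extension `p_e(L)` iff either `n+1 ∉ J` and `J` is a basis of `L`, or `n+1 ∈ J`,
`e ∉ J`, and `(J ∖ {n+1}) ∪ {e}` is a basis of `L`. In particular the bases of
`p_e(L)` are determined by the bases of `L`. -/
theorem stmt10 {n d : ℕ} (L : Submodule ℂ (Fin n → ℂ))
    (hdim : Module.finrank ℂ L = d) (e : Fin n)
    (J : Finset (Fin (n + 1))) (hJ : J.card = d) :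
    IsBasisOf (L.map (parExtMap n e)) J ↔
      ((Fin.last n ∉ J ∧
          IsBasisOf L (J.preimage Fin.castSucc (Fin.castSucc_injective n).injOn)) ∨
        (Fin.last n ∈ J ∧ e.castSucc ∉ J ∧
          IsBasisOf L
            (insert e (J.preimage Fin.castSucc (Fin.castSucc_injective n).injOn)))) := by
  set I := J.preimage Fin.castSucc (Fin.castSucc_injective n).injOn with hI
  have hmem : ∀ i, i ∈ I ↔ i.castSucc ∈ J := fun i => by simp [hI]
  have hcard : I.card = (J.erase (Fin.last n)).card := by
    rw [← map_castSucc_preimage J, Finset.card_map]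
  have hrank : Module.finrank ℂ (L.map (parExtMap n e)) = d := by
    rw [← hdim]
    exact (L.equivMapOfInjective _ (parExtMap_injective e)).finrank_eq.symm
  have hmap : IsBasisOf (L.map (parExtMap n e)) J ↔
      ∀ v ∈ L, ((∀ i ∈ I, v i = 0) ∧ (Fin.last n ∈ J → v e = 0)) → v = 0 := by
    rw [isBasisOf_iff_forall _ _ (hJ.trans hrank.symm)]
    simp only [Submodule.mem_map, forall_exists_index, and_imp, forall_apply_eq_imp_iff₂,
      map_eq_zero_iff _ (parExtMap_injective e), Fin.forall_fin_succ', parExtMap_castSucc,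
      parExtMap_last, hmem]
  rw [hmap]
  by_cases hl : Fin.last n ∈ J
  · have hc : I.card + 1 = d := by
      rw [hcard, Finset.card_erase_add_one hl, hJ]
    simp only [hl, not_true_eq_false, false_and, false_or, true_and, forall_const, ← hmem]
    by_cases he : e ∈ I
    · simp only [he, not_true_eq_false, false_and, iff_false]
      intro h
      have := finrank_le_card_of_forall L I fun v hv h0 => h v hv ⟨h0, h0 e he⟩
      omega
    · rw [isBasisOf_iff_forall L (insert e I) (by rw [Finset.card_insert_of_notMem he, hc, hdim])]
      simp [he, and_comm]
  · have hc : I.card = d := by rw [hcard, Finset.erase_eq_of_notMem hl, hJ]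
    rw [isBasisOf_iff_forall L I (hc.trans hdim.symm)]
    simp [hl]
end
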